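/- Exact Z-insertion identity for time-reversal symmetric pulse sequences: for every k : ℕ, θ φ : Fin k → ℝ, and β : ℝ, letting A := [θ₁]_{φ₁} · ⋯ · [θ_k]_{φ_k} and B := [θ_k]_{φ_k} · ⋯ · [θ₁]_{φ₁} (the reversed ordered product), one has A · Z(β) · B = cos(β/2) · (A · B) − i · sin(β/2) · σz. -/

import Mathlib

open Complex Matrix

noncomputable section

/-- The pulse `[θ]_φ = exp(-i(θ/2)(cos φ σx + sin φ σy))`. -/
def pulse (θ φ : ℝ) : Matrix (Fin 2) (Fin 2) ℂ :=
  !![(Real.cos (θ/2) : ℂ), -Complex.I * Complex.exp (-Complex.I * φ) * Real.sin (θ/2);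
     -Complex.I * Complex.exp (Complex.I * φ) * Real.sin (θ/2), (Real.cos (θ/2) : ℂ)]

/-- The Z-rotation `Z(φ)`. -/
def Zrot (φ : ℝ) : Matrix (Fin 2) (Fin 2) ℂ :=
  !![Complex.exp (-Complex.I * φ / 2), 0; 0, Complex.exp (Complex.I * φ / 2)]

/-- The Pauli matrix `σz`. -/
def σz : Matrix (Fin 2) (Fin 2) ℂ := !![1, 0; 0, -1]

attribute [local instance] Matrix.normedAddCommGroup Matrix.normedSpace

/-- If every member `a` of a list satisfies `a * s * a = s`, then the list's product and its reversed
product sandwich `s` to itself. -/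
theorem List.prod_mul_mul_reverse_prod {M : Type*} [Monoid M] {s : M} {l : List M}
    (h : ∀ a ∈ l, a * s * a = s) : l.prod * s * l.reverse.prod = s := by
  induction l with
  | nil => simp
  | cons a l ih =>
    have ih := ih fun b hb => h b (List.mem_cons_of_mem _ hb)
    calc (a :: l).prod * s * (a :: l).reverse.prod
        = a * (l.prod * s * l.reverse.prod) * a := by simp [mul_assoc]
      _ = s := by rw [ih, h a List.mem_cons_self]

theorem pulse_mul_σz_mul_pulse (θ φ : ℝ) : pulse θ φ * σz * pulse θ φ = σz := by
  have hexp : Complex.exp (-Complex.I * φ) * Complex.exp (Complex.I * φ) = 1 := by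
    rw [← Complex.exp_add]; simp
  have htrig := Complex.sin_sq_add_cos_sq ((θ : ℂ) / 2)
  ext i j
  fin_cases i <;> fin_cases j <;>
    simp only [pulse, σz, Matrix.mul_apply, Fin.sum_univ_two, Matrix.of_apply, Matrix.cons_val',
      Matrix.cons_val_zero, Matrix.cons_val_one, Matrix.cons_val_fin_one, Fin.zero_eta, Fin.mk_one,
      Complex.ofReal_cos, Complex.ofReal_sin, Complex.ofReal_div, Complex.ofReal_ofNat]
  · linear_combination htrig + Complex.sin (θ / 2) ^ 2 * hexp - Complex.sin (θ / 2) ^ 2 *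
      Complex.exp (-Complex.I * φ) * Complex.exp (Complex.I * φ) * Complex.I_sq
  · ring
  · ring
  · linear_combination -htrig - Complex.sin (θ / 2) ^ 2 * hexp + Complex.sin (θ / 2) ^ 2 *
      Complex.exp (-Complex.I * φ) * Complex.exp (Complex.I * φ) * Complex.I_sq

theorem Zrot_eq (β : ℝ) :
    Zrot β = (Real.cos (β / 2) : ℂ) • 1 - (Complex.I * Real.sin (β / 2)) • σz := by
  have hneg : -Complex.I * β / 2 = ((-(β / 2) : ℝ) : ℂ) * Complex.I := by push_cast; ring
  have hpos : Complex.I * β / 2 = ((β / 2 : ℝ) : ℂ) * Complex.I := by push_cast; ring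
  rw [Zrot, hneg, hpos, Complex.exp_mul_I, Complex.exp_mul_I, σz, Matrix.one_fin_two]
  ext i j
  fin_cases i <;> fin_cases j <;> simp [Complex.cos_neg, Complex.sin_neg] <;> ring

/-- Exact Z-insertion identity for time-reversal symmetric pulse sequences. -/
theorem Z_insertion_identity
    (k : ℕ) (θ φ : Fin k → ℝ) (β : ℝ) :
    (List.ofFn fun i => pulse (θ i) (φ i)).prod * Zrot β *
        (List.ofFn fun i => pulse (θ i) (φ i)).reverse.prod
      = (Real.cos (β / 2) : ℂ) •
          ((List.ofFn fun i => pulse (θ i) (φ i)).prod *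
            (List.ofFn fun i => pulse (θ i) (φ i)).reverse.prod)
        - (Complex.I * Real.sin (β / 2)) • σz := by
  have hz : (List.ofFn fun i => pulse (θ i) (φ i)).prod * σz *
      (List.ofFn fun i => pulse (θ i) (φ i)).reverse.prod = σz := by
    refine List.prod_mul_mul_reverse_prod fun a ha => ?_
    obtain ⟨i, rfl⟩ := List.mem_ofFn.mp ha
    exact pulse_mul_σz_mul_pulse (θ i) (φ i)
  rw [Zrot_eq, mul_sub, sub_mul, mul_smul_comm, mul_smul_comm, smul_mul_assoc, smul_mul_assoc,
    mul_one, hz]
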